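/- arXiv:2202.03762 — 13 statements merged into one kernel-verified Lean document; each statement's English description precedes it below -/
import Mathlib

section
/- For every front-running input a > 0, the victim's realized output is strictly smaller than the expected output: δ̃_vy(a) < δ_vy. -/
/-- CPMM pool with reserves `x0 > 0`, `y0 > 0`, fee `0 ≤ f < 1`. Victim trades `δ > 0`
tokens X, expecting `δ_vy = y0(1−f)δ/(x0+(1−f)δ)`. After a front-run of `a > 0`, the
reserves are `x1 a = x0 + a`, `y1 a = x0·y0/(x0+(1−f)a)` and the realized output is
`δ̃_vy a = y1 a · (1−f)δ/(x1 a + (1−f)δ)`. For every `a > 0`, `δ̃_vy a < δ_vy`. -/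
theorem victim_output_strictly_smaller
    (x0 y0 f δ : ℝ) (hx0 : 0 < x0) (hy0 : 0 < y0) (hf0 : 0 ≤ f) (hf1 : f < 1)
    (hδ : 0 < δ)
    (δvy : ℝ) (hδvy : δvy = y0 * (1 - f) * δ / (x0 + (1 - f) * δ))
    (x1 y1 δvyT : ℝ → ℝ)
    (hx1 : ∀ a, x1 a = x0 + a)
    (hy1 : ∀ a, y1 a = x0 * y0 / (x0 + (1 - f) * a))
    (hδT : ∀ a, δvyT a = y1 a * (1 - f) * δ / (x1 a + (1 - f) * δ)) :
    ∀ a : ℝ, 0 < a → δvyT a < δvy := by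
  intro a ha
  have hg : 0 < 1 - f := by linarith
  have hgd : 0 < (1 - f) * δ := mul_pos hg hδ
  have hga : 0 < (1 - f) * a := mul_pos hg ha
  rw [hδT, hx1, hy1, hδvy]
  have h1 : x0 * y0 / (x0 + (1 - f) * a) < y0 := by
    rw [div_lt_iff₀ (by linarith)]
    nlinarith [mul_pos hy0 hga]
  have h2 : x0 * y0 / (x0 + (1 - f) * a) * (1 - f) * δ < y0 * (1 - f) * δ :=
    mul_lt_mul_of_pos_right (mul_lt_mul_of_pos_right h1 hg) hδ
  exact div_lt_div₀ h2 (by linarith) (by positivity) (by linarith)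
end

section
/- Suppose 0 < f < 1, x0 − (1−f)²f(δ + x0) ≥ 0, and (2−f)x0 > δ(1−f)². Let δᵒ = [δ(1−f)²x0 − (2−f)f·x0² + √(δ²(1−f)³x0(x0 − (1−f)²f(δ + x0)))] / [(2−f)f·x0 − δ(1−f)²f]. Then δᵒ is the unique positive zero of the derivative of the attacker's gross profit: for every a > 0 with g'(a) = 0 one has a = δᵒ. -/
/-- Sandwich attack with fee `f`. After front-run of `a`: `x1 a = x0 + a`,
`y1 a = x0·y0/(x0+(1−f)a)`; after victim's trade of `δ`: `x2 a = x1 a + δ`,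
`y2 a = x1 a · y1 a / (x1 a + (1−f)δ)`; attacker receives
`δout a = x2 a (1−f) δay a / (y2 a + (1−f) δay a)` for `δay a = y0(1−f)a/(x0+(1−f)a)`,
and `g a = δout a − a`. Under the stated hypotheses the closed-form `δᵒ` is positive
and `g'(δᵒ) = 0`. -/
theorem optimal_input_unique_critical_point
    (x0 y0 f δ : ℝ) (hx0 : 0 < x0) (hy0 : 0 < y0) (hf0 : 0 < f) (hf1 : f < 1)
    (hδ : 0 < δ)
    (h1 : 0 ≤ x0 - (1 - f) ^ 2 * f * (δ + x0))
    (h2 : δ * (1 - f) ^ 2 < (2 - f) * x0)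
    (δay x1 y1 x2 y2 δout g : ℝ → ℝ)
    (hδay : ∀ a, δay a = y0 * (1 - f) * a / (x0 + (1 - f) * a))
    (hx1 : ∀ a, x1 a = x0 + a)
    (hy1 : ∀ a, y1 a = x0 * y0 / (x0 + (1 - f) * a))
    (hx2 : ∀ a, x2 a = x1 a + δ)
    (hy2 : ∀ a, y2 a = x1 a * y1 a / (x1 a + (1 - f) * δ))
    (hδout : ∀ a, δout a = x2 a * (1 - f) * δay a / (y2 a + (1 - f) * δay a))
    (hg : ∀ a, g a = δout a - a)
    (δo : ℝ)
    (hδo : δo = (δ * (1 - f) ^ 2 * x0 - (2 - f) * f * x0 ^ 2 +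
        Real.sqrt (δ ^ 2 * (1 - f) ^ 3 * x0 * (x0 - (1 - f) ^ 2 * f * (δ + x0)))) /
        ((2 - f) * f * x0 - δ * (1 - f) ^ 2 * f)) :
    ∀ a : ℝ, 0 < a → deriv g a = 0 → a = δo := by
  intro a ha hd
  have hr : 0 < 1 - f := by linarith
  obtain ⟨p, hp⟩ : ∃ p, p = (1 - f) ^ 2 * (x0 + δ) - x0 := ⟨_, rfl⟩
  obtain ⟨q, hq⟩ : ∃ q, q = (1 - f) ^ 2 * (x0 + δ) * (x0 + (1 - f) * δ) - x0 ^ 2 := ⟨_, rfl⟩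
  obtain ⟨s, hs⟩ : ∃ s, s = x0 + (1 - f) ^ 2 * x0 + (1 - f) ^ 3 * δ := ⟨_, rfl⟩
  obtain ⟨A, hA⟩ : ∃ A, A = (2 - f) * f * x0 - δ * (1 - f) ^ 2 * f := ⟨_, rfl⟩
  have hs0 : 0 < s := by rw [hs]; positivity
  have hApos : 0 < A := by rw [hA]; nlinarith
  have hgf : ∀ b, 0 < b → g b = (p * b ^ 2 + q * b) / ((1 - f) ^ 2 * b ^ 2 + s * b + x0 ^ 2) := by
    intro b hb
    have e0 : 0 < (1 - f) ^ 2 * b ^ 2 + s * b + x0 ^ 2 := by positivity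
    have e1 : 0 < x0 + (1 - f) * b := by positivity
    have e2 : 0 < x0 + b + (1 - f) * δ := by positivity
    have e3 : y2 b + (1 - f) * δay b = y0 * ((1 - f) ^ 2 * b ^ 2 + s * b + x0 ^ 2) /
        ((x0 + (1 - f) * b) * (x0 + b + (1 - f) * δ)) := by
      rw [hy2, hx1, hy1, hδay, hs]
      field_simp
      ring
    rw [hg, hδout, e3, hx2, hx1, hδay, eq_div_iff e0.ne']
    generalize hD : (1 - f) ^ 2 * b ^ 2 + s * b + x0 ^ 2 = D at *
    field_simp
    rw [← hD, hs, hp, hq]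
    ring
  have e0 : 0 < (1 - f) ^ 2 * a ^ 2 + s * a + x0 ^ 2 := by positivity
  have hev : g =ᶠ[nhds a] fun b => (p * b ^ 2 + q * b) / ((1 - f) ^ 2 * b ^ 2 + s * b + x0 ^ 2) := by
    filter_upwards [lt_mem_nhds ha] with b hb using hgf b hb
  have n1 : HasDerivAt (fun b : ℝ => p * b ^ 2 + q * b) (p * (2 * a) + q) a := by
    have := ((hasDerivAt_pow 2 a).const_mul p).add ((hasDerivAt_id a).const_mul q)
    exact this.congr_deriv (by norm_num)
  have n2 : HasDerivAt (fun b : ℝ => (1 - f) ^ 2 * b ^ 2 + s * b + x0 ^ 2)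
      ((1 - f) ^ 2 * (2 * a) + s) a := by
    have := (((hasDerivAt_pow 2 a).const_mul ((1 - f) ^ 2)).add
      ((hasDerivAt_id a).const_mul s)).add_const (x0 ^ 2)
    exact this.congr_deriv (by norm_num)
  have hder := (n1.div n2 e0.ne').congr_of_eventuallyEq hev
  rw [hder.deriv, div_eq_zero_iff] at hd
  have hd' := hd.resolve_right (by positivity)
  have hqp : q = p * (x0 + (1 - f) * δ) + x0 * (1 - f) * δ := by rw [hq, hp]; ring
  have key : A * a ^ 2 - 2 * p * x0 * a - q * x0 = 0 := by
    have : x0 * (A * a ^ 2 - 2 * p * x0 * a - q * x0) = 0 := by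
      rw [← neg_eq_zero, ← hd', hA, hq, hp, hs]; ring
    exact (mul_eq_zero.mp this).resolve_left hx0.ne'
  have hnn : 0 ≤ A * a - p * x0 := by
    rcases le_or_gt p 0 with h | h
    · have := mul_pos hApos ha
      nlinarith
    · have hqpos : 0 < q := by rw [hqp]; positivity
      have h3 : 0 < (A * a - p * x0) * a := by
        have : (A * a - p * x0) * a = p * x0 * a + q * x0 := by linarith
        rw [this]; positivity
      exact (pos_of_mul_pos_left h3 ha.le).le
  have hsq : δ ^ 2 * (1 - f) ^ 3 * x0 * (x0 - (1 - f) ^ 2 * f * (δ + x0)) = (A * a - p * x0) ^ 2 := by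
    have : (A * a - p * x0) ^ 2 = A * (A * a ^ 2 - 2 * p * x0 * a - q * x0) + (p ^ 2 * x0 ^ 2 + A * q * x0) := by
      ring
    rw [this, key, hA, hq, hp]; ring
  rw [hδo, hsq, Real.sqrt_sq hnn, ← hA, eq_div_iff hApos.ne', hp]
  ring
end

section
/- Suppose 0 < f < 1, x0 − (1−f)²f(δ + x0) ≥ 0, and (2−f)x0 > δ(1−f)². Let δᵒ = [δ(1−f)²x0 − (2−f)f·x0² + √(δ²(1−f)³x0(x0 − (1−f)²f(δ + x0)))] / [(2−f)f·x0 − δ(1−f)²f]. Then the second derivative of the attacker's gross profit is strictly negative at δᵒ: g''(δᵒ) < 0. -/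
/-- Sandwich attack with fee `f`. After front-run of `a`: `x1 a = x0 + a`,
`y1 a = x0·y0/(x0+(1−f)a)`; after victim's trade of `δ`: `x2 a = x1 a + δ`,
`y2 a = x1 a · y1 a / (x1 a + (1−f)δ)`; attacker receives
`δout a = x2 a (1−f) δay a / (y2 a + (1−f) δay a)` for `δay a = y0(1−f)a/(x0+(1−f)a)`,
and `g a = δout a − a`. Under the stated hypotheses the closed-form `δᵒ` is positive
and `g'(δᵒ) = 0`. -/
theorem second_derivative_negative_at_optimum
    (x0 y0 f δ : ℝ) (hx0 : 0 < x0) (hy0 : 0 < y0) (hf0 : 0 < f) (hf1 : f < 1)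
    (hδ : 0 < δ)
    (h1 : 0 ≤ x0 - (1 - f) ^ 2 * f * (δ + x0))
    (h2 : δ * (1 - f) ^ 2 < (2 - f) * x0)
    (δay x1 y1 x2 y2 δout g : ℝ → ℝ)
    (hδay : ∀ a, δay a = y0 * (1 - f) * a / (x0 + (1 - f) * a))
    (hx1 : ∀ a, x1 a = x0 + a)
    (hy1 : ∀ a, y1 a = x0 * y0 / (x0 + (1 - f) * a))
    (hx2 : ∀ a, x2 a = x1 a + δ)
    (hy2 : ∀ a, y2 a = x1 a * y1 a / (x1 a + (1 - f) * δ))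
    (hδout : ∀ a, δout a = x2 a * (1 - f) * δay a / (y2 a + (1 - f) * δay a))
    (hg : ∀ a, g a = δout a - a)
    (δo : ℝ)
    (hδo : δo = (δ * (1 - f) ^ 2 * x0 - (2 - f) * f * x0 ^ 2 +
        Real.sqrt (δ ^ 2 * (1 - f) ^ 3 * x0 * (x0 - (1 - f) ^ 2 * f * (δ + x0)))) /
        ((2 - f) * f * x0 - δ * (1 - f) ^ 2 * f)) :
    deriv (deriv g) δo < 0 := by
  obtain ⟨q, rfl⟩ : ∃ q, f = 1 - q := ⟨1 - f, by ring⟩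
  have hq0 : 0 < q := by linarith
  have hq1 : q < 1 := by linarith
  simp only [sub_sub_cancel] at *
  have hstrict : 0 < x0 - q ^ 2 * (1 - q) * (δ + x0) := by
    have e1 := mul_lt_mul_of_pos_right h2 hf0
    have e2 : 0 < q ^ 3 * x0 := by positivity
    nlinarith
  set R := δ ^ 2 * q ^ 3 * x0 * (x0 - q ^ 2 * (1 - q) * (δ + x0)) with hR
  have hRpos : 0 < R := by positivity
  set s := Real.sqrt R with hs
  have hspos : 0 < s := Real.sqrt_pos.mpr hRpos
  have hss : s ^ 2 = R := Real.sq_sqrt hRpos.le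
  obtain ⟨E, hE⟩ : ∃ E, E = (2 - (1 - q)) * (1 - q) * x0 - δ * q ^ 2 * (1 - q) := ⟨_, rfl⟩
  have hEpos : 0 < E := by
    have := mul_lt_mul_of_pos_right h2 hf0
    rw [hE]; nlinarith
  rw [← hE] at hδo
  obtain ⟨t, ht⟩ : ∃ t, t = δo + x0 := ⟨_, rfl⟩
  have htE : t * E = q ^ 3 * δ * x0 + s := by
    have : δo * E = δ * q ^ 2 * x0 - (2 - (1 - q)) * (1 - q) * x0 ^ 2 + s := by
      rw [hδo]; field_simp
    rw [ht, add_mul, this, hE]; ring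
  have htpos : 0 < t := by
    have : 0 < t * E := by rw [htE]; positivity
    exact pos_of_mul_pos_left this hEpos.le
  have hquad : E * t ^ 2 = q ^ 3 * δ * x0 * (2 * t + δ) := by
    have h : E * (E * t ^ 2) = E * (q ^ 3 * δ * x0 * (2 * t + δ)) := by
      have e1 : E * (E * t ^ 2) = (t * E) ^ 2 := by ring
      have e2 : E * (q ^ 3 * δ * x0 * (2 * t + δ))
        = q ^ 3 * δ * x0 * (2 * (t * E) + δ * E) := by ring
      rw [e1, e2, htE]
      have : (q ^ 3 * δ * x0 + s) ^ 2 = (q ^ 3 * δ * x0) ^ 2 + 2 * (q ^ 3 * δ * x0) * s + R := by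
        rw [← hss]; ring
      rw [this, hR, hE]; ring
    exact mul_left_cancel₀ hEpos.ne' h
  let D : ℝ → ℝ := fun a => (x0 + a) * x0 + q ^ 2 * a * (x0 + a + q * δ)
  let α : ℝ := q ^ 2 * δ - (1 - q ^ 2) * x0
  let β : ℝ := α * x0 + q ^ 3 * δ * (x0 + δ)
  let P : ℝ → ℝ := fun a => -x0 * (E * a ^ 2 - 2 * α * x0 * a - β * x0)
  have hDpos : 0 < D δo := by
    by_contra hcon
    have hcon' : D δo ≤ 0 := not_lt.mp hcon
    have e0 : δo = t - x0 := by linarith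
    have e1 : t * D δo ≤ 0 := mul_nonpos_of_nonneg_of_nonpos htpos.le hcon'
    have e2 : t * D δo = q ^ 3 * δ * x0 * (t + δ) + (1 - q) * q ^ 2 * δ * t ^ 2
        + q ^ 2 * t ^ 3 + q ^ 3 * δ * t ^ 2 := by
      have : (1 - q ^ 2) * x0 * t ^ 2 = q ^ 3 * δ * x0 * (2 * t + δ) + (1 - q) * q ^ 2 * δ * t ^ 2 := by
        rw [← hquad, hE]; ring
      simp only [D]
      rw [e0]
      linear_combination this
    have : 0 < t * D δo := by rw [e2]; positivity
    linarith
  have hPzero : P δo = 0 := by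
    have e0 : δo = t - x0 := by linarith
    simp only [P, α, β]
    rw [e0]
    have : E = (1 + q) * (1 - q) * x0 - δ * q ^ 2 * (1 - q) := by rw [hE]; ring
    have e3 : E * (t - x0) ^ 2 = q ^ 3 * δ * x0 * (2 * t + δ) - 2 * t * x0 * E + x0 ^ 2 * E := by
      rw [← hquad]; ring
    rw [e3, this]; ring
  let U : Set ℝ := {a | 0 < x0 + a ∧ 0 < D a}
  have hDcont : Continuous D := by fun_prop
  have hU : IsOpen U := by
    apply IsOpen.inter
    · exact isOpen_lt continuous_const (continuous_const.add continuous_id)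
    · exact isOpen_lt continuous_const hDcont
  have hoU : δo ∈ U := ⟨by linarith, hDpos⟩
  have hDd : ∀ a, HasDerivAt D (2 * q ^ 2 * a + (x0 + q ^ 2 * x0 + q ^ 3 * δ)) a := by
    intro a
    have h := ((((hasDerivAt_id a).const_add x0).mul_const x0)).add
      (((hasDerivAt_id a).const_mul (q ^ 2)).mul
        (((hasDerivAt_id a).const_add x0).add_const (q * δ)))
    exact h.congr_deriv (by simp only [id]; ring)
  have hPd : HasDerivAt P (-x0 * (2 * E * δo - 2 * α * x0)) δo := by
    have h := (((((hasDerivAt_id δo).pow 2).const_mul E).sub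
      ((hasDerivAt_id δo).const_mul (2 * α * x0))).sub_const (β * x0)).const_mul (-x0)
    exact h.congr_deriv (by simp only [id]; push_cast; ring)
  have hgU : ∀ a ∈ U, g a = a * (α * a + β) / D a := by
    rintro a ⟨ha, hDa⟩
    have k1 : 0 < x0 + q * a := by nlinarith
    have k2 : 0 < x0 + a + q * δ := by positivity
    have k3 : x0 + q * a ≠ 0 := k1.ne'
    have hden : (x0 + a) * (x0 * y0 / (x0 + q * a)) / (x0 + a + q * δ)
        + q * (y0 * q * a / (x0 + q * a)) = y0 * D a / ((x0 + q * a) * (x0 + a + q * δ)) := by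
      simp only [D]; field_simp
    rw [hg, hδout, hy2, hx2, hx1, hy1, hδay, hden]
    have hDa' : D a ≠ 0 := hDa.ne'
    have : (x0 + a + δ) * q * (y0 * q * a / (x0 + q * a)) /
        (y0 * D a / ((x0 + q * a) * (x0 + a + q * δ)))
        = q ^ 2 * a * (x0 + a + δ) * (x0 + a + q * δ) / D a := by
      clear hden
      generalize x0 + q * a = w at *
      generalize D a = d at *
      field_simp
    rw [this, eq_div_iff hDa', sub_mul, div_mul_cancel₀ _ hDa']
    simp only [D, α, β]; ring
  have hg1 : ∀ a ∈ U, deriv g a = P a / D a ^ 2 := by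
    intro a haU
    have hev : g =ᶠ[nhds a] fun a => a * (α * a + β) / D a := by
      filter_upwards [hU.mem_nhds haU] with b hb using hgU b hb
    rw [hev.deriv_eq]
    have h := ((hasDerivAt_id a).mul (((hasDerivAt_id a).const_mul α).add_const β)).div
      (hDd a) haU.2.ne'
    have h' := h.deriv
    refine Eq.trans h' ?_
    congr 1
    simp only [Pi.mul_apply, id, D, P, α, β]
    rw [hE]; ring
  have hev : deriv g =ᶠ[nhds δo] fun a => P a / D a ^ 2 := by
    filter_upwards [hU.mem_nhds hoU] with b hb using hg1 b hb
  rw [hev.deriv_eq]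
  have h := (hPd.div ((hDd δo).pow 2) (pow_ne_zero 2 hDpos.ne')).deriv
  refine lt_of_eq_of_lt h ?_
  rw [hPzero, zero_mul, sub_zero]
  have hk : -x0 * (2 * E * δo - 2 * α * x0) = -(2 * x0 * s) := by
    have e0 : δo = t - x0 := by linarith
    have : s = t * E - q ^ 3 * δ * x0 := by linarith
    rw [this, e0]; simp only [α]; rw [hE]; ring
  rw [hk]
  apply div_neg_of_neg_of_pos
  · simp only [Pi.pow_apply]
    have : 0 < 2 * x0 * s * D δo ^ 2 := by positivity
    linarith
  · simp only [Pi.pow_apply]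
    positivity
end

section
/- Suppose 0 < f < 1, x0 − (1−f)²f(δ + x0) ≥ 0, and (2−f)x0 > δ(1−f)². Let δᵒ = [δ(1−f)²x0 − (2−f)f·x0² + √(δ²(1−f)³x0(x0 − (1−f)²f(δ + x0)))] / [(2−f)f·x0 − δ(1−f)²f]. Then δᵒ is the attacker's optimal unconstrained input: for every a > 0, g(a) ≤ g(δᵒ). -/
/-- Sandwich attack with fee `f`. After front-run of `a`: `x1 a = x0 + a`,
`y1 a = x0·y0/(x0+(1−f)a)`; after victim's trade of `δ`: `x2 a = x1 a + δ`,
`y2 a = x1 a · y1 a / (x1 a + (1−f)δ)`; attacker receives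
`δout a = x2 a (1−f) δay a / (y2 a + (1−f) δay a)` for `δay a = y0(1−f)a/(x0+(1−f)a)`,
and `g a = δout a − a`. Under the stated hypotheses the closed-form `δᵒ` is positive
and `g'(δᵒ) = 0`. -/
theorem optimal_unconstrained_input
    (x0 y0 f δ : ℝ) (hx0 : 0 < x0) (hy0 : 0 < y0) (hf0 : 0 < f) (hf1 : f < 1)
    (hδ : 0 < δ)
    (h1 : 0 ≤ x0 - (1 - f) ^ 2 * f * (δ + x0))
    (h2 : δ * (1 - f) ^ 2 < (2 - f) * x0)
    (δay x1 y1 x2 y2 δout g : ℝ → ℝ)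
    (hδay : ∀ a, δay a = y0 * (1 - f) * a / (x0 + (1 - f) * a))
    (hx1 : ∀ a, x1 a = x0 + a)
    (hy1 : ∀ a, y1 a = x0 * y0 / (x0 + (1 - f) * a))
    (hx2 : ∀ a, x2 a = x1 a + δ)
    (hy2 : ∀ a, y2 a = x1 a * y1 a / (x1 a + (1 - f) * δ))
    (hδout : ∀ a, δout a = x2 a * (1 - f) * δay a / (y2 a + (1 - f) * δay a))
    (hg : ∀ a, g a = δout a - a)
    (δo : ℝ)
    (hδo : δo = (δ * (1 - f) ^ 2 * x0 - (2 - f) * f * x0 ^ 2 +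
        Real.sqrt (δ ^ 2 * (1 - f) ^ 3 * x0 * (x0 - (1 - f) ^ 2 * f * (δ + x0)))) /
        ((2 - f) * f * x0 - δ * (1 - f) ^ 2 * f)) :
    ∀ a : ℝ, 0 < a → g a ≤ g δo := by
  have key : ∀ a, 0 < x0 + a →
      0 < x0 * (x0 + a) + (1 - f) ^ 2 * a * (x0 + a + (1 - f) * δ) →
      g a = ((1 - f) ^ 2 * a * (x0 + a + δ) * (x0 + a + (1 - f) * δ)) /
        (x0 * (x0 + a) + (1 - f) ^ 2 * a * (x0 + a + (1 - f) * δ)) - a := by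
    intro a ha hD
    have hr : 0 < 1 - f := by linarith
    have e1 : 0 < x0 + (1 - f) * a := by nlinarith
    have e2 : 0 < x0 + a + (1 - f) * δ := by positivity
    have e3 : y2 a + (1 - f) * δay a =
        y0 * (x0 * (x0 + a) + (1 - f) ^ 2 * a * (x0 + a + (1 - f) * δ)) /
        ((x0 + (1 - f) * a) * (x0 + a + (1 - f) * δ)) := by
      rw [hy2, hy1, hx1, hδay]
      field_simp
    rw [hg, hδout, e3, hx2, hx1, hδay]
    congr 1
    have := e1.ne'
    have := e2.ne'
    have := hD.ne'
    generalize x0 * (x0 + a) + (1 - f) ^ 2 * a * (x0 + a + (1 - f) * δ) = D at *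
    generalize x0 + (1 - f) * a = U at *
    generalize x0 + a + (1 - f) * δ = V at *
    field_simp
  obtain ⟨r, hr⟩ : ∃ r, r = 1 - f := ⟨_, rfl⟩
  have hf : f = 1 - r := by linarith
  have hr0 : 0 < r := by linarith
  have hr1 : 0 < 1 - r := by linarith
  have hS := Real.sq_sqrt (show 0 ≤ δ ^ 2 * (1 - f) ^ 3 * x0 * (x0 - (1 - f) ^ 2 * f * (δ + x0)) by
    rw [← hr] at h1 ⊢; positivity)
  have hs0 := Real.sqrt_nonneg (δ ^ 2 * (1 - f) ^ 3 * x0 * (x0 - (1 - f) ^ 2 * f * (δ + x0)))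
  generalize Real.sqrt (δ ^ 2 * (1 - f) ^ 3 * x0 * (x0 - (1 - f) ^ 2 * f * (δ + x0))) = s at *
  have hQ : 0 < (2 - f) * f * x0 - δ * (1 - f) ^ 2 * f := by nlinarith
  rw [eq_div_iff hQ.ne'] at hδo
  subst hf
  simp only [sub_sub_cancel] at *
  obtain ⟨Q, hQe⟩ : ∃ Q, Q = (2 - (1 - r)) * (1 - r) * x0 - δ * r ^ 2 * (1 - r) := ⟨_, rfl⟩
  rw [← hQe] at hQ hδo
  have ht : Q * (x0 + δo) = r ^ 3 * δ * x0 + s := by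
    have : Q * x0 = ((2 - (1 - r)) * (1 - r) * x0 - δ * r ^ 2 * (1 - r)) * x0 := by rw [hQe]
    linear_combination hδo + this
  have hto : 0 < x0 + δo := by
    have : 0 < Q * (x0 + δo) := by rw [ht]; positivity
    exact (pos_iff_pos_of_mul_pos this).1 hQ
  have hDo : 0 < x0 * (x0 + δo) + r ^ 2 * δo * (x0 + δo + r * δ) := by
    have hu : 0 < 1 - r ^ 2 := by nlinarith
    have e : Q ^ 2 * (x0 * (x0 + δo) + r ^ 2 * δo * (x0 + δo + r * δ)) =
      r ^ 2 * (Q * (x0 + δo)) ^ 2 + Q * s * ((1 - r ^ 2) * x0 + r ^ 3 * δ)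
        + r ^ 3 * δ * x0 * Q * r ^ 2 * δ := by
      have : s = Q * (x0 + δo) - r ^ 3 * δ * x0 := by linarith
      rw [this]
      linear_combination (- r ^ 3 * δ * x0 * Q) * hQe
    have : 0 < Q ^ 2 * (x0 * (x0 + δo) + r ^ 2 * δo * (x0 + δo + r * δ)) := by
      rw [e]; positivity
    exact (pos_iff_pos_of_mul_pos this).1 (by positivity)
  intro a ha
  have hDa : 0 < x0 * (x0 + a) + r ^ 2 * a * (x0 + a + r * δ) := by positivity
  rw [key a (by positivity) hDa, key δo hto hDo, div_sub' hDa.ne', div_sub' hDo.ne',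
    div_le_div_iff₀ hDa hDo, ← sub_nonneg]
  have crit : Q * δo ^ 2 - 2 * ((r ^ 2 - 1) * x0 + r ^ 2 * δ) * x0 * δo
      - ((r ^ 2 - 1) * x0 ^ 2 + r ^ 2 * (1 + r) * δ * x0 + r ^ 3 * δ ^ 2) * x0 = 0 := by
    have hs : s = Q * δo - ((r ^ 2 - 1) * x0 + r ^ 2 * δ) * x0 := by linear_combination -hδo
    rw [hs] at hS
    have : Q * (Q * δo ^ 2 - 2 * ((r ^ 2 - 1) * x0 + r ^ 2 * δ) * x0 * δo
      - ((r ^ 2 - 1) * x0 ^ 2 + r ^ 2 * (1 + r) * δ * x0 + r ^ 3 * δ ^ 2) * x0) = 0 := by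
      linear_combination hS - (((r ^ 2 - 1) * x0 ^ 2 + r ^ 2 * (1 + r) * δ * x0 + r ^ 3 * δ ^ 2) * x0) * hQe
    exact (mul_eq_zero.1 this).resolve_left hQ.ne'
  have h : 0 ≤ x0 * s * (a - δo) ^ 2 := by positivity
  have hs : s = Q * δo - ((r ^ 2 - 1) * x0 + r ^ 2 * δ) * x0 := by linear_combination -hδo
  refine h.trans_eq ?_
  rw [hs]
  have c2 := crit
  subst hQe
  linear_combination (x0 * (δo - a)) * c2
end

section
/- Suppose 0 < f < 1, x0 − (1−f)²f(δ + x0) ≥ 0, and (2−f)x0 > δ(1−f)². Let δᵒ = [δ(1−f)²x0 − (2−f)f·x0² + √(δ²(1−f)³x0(x0 − (1−f)²f(δ + x0)))] / [(2−f)f·x0 − δ(1−f)²f]. Then the attacker's gross profit g is strictly increasing on (0, δᵒ] and strictly decreasing on [δᵒ, ∞). -/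
set_option maxHeartbeats 1000000

/-- Sandwich attack with fee `f`. After front-run of `a`: `x1 a = x0 + a`,
`y1 a = x0·y0/(x0+(1−f)a)`; after victim's trade of `δ`: `x2 a = x1 a + δ`,
`y2 a = x1 a · y1 a / (x1 a + (1−f)δ)`; attacker receives
`δout a = x2 a (1−f) δay a / (y2 a + (1−f) δay a)` for `δay a = y0(1−f)a/(x0+(1−f)a)`,
and `g a = δout a − a`. Under the stated hypotheses the closed-form `δᵒ` is positive
and `g'(δᵒ) = 0`. -/
theorem profit_unimodal
    (x0 y0 f δ : ℝ) (hx0 : 0 < x0) (hy0 : 0 < y0) (hf0 : 0 < f) (hf1 : f < 1)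
    (hδ : 0 < δ)
    (h1 : 0 ≤ x0 - (1 - f) ^ 2 * f * (δ + x0))
    (h2 : δ * (1 - f) ^ 2 < (2 - f) * x0)
    (δay x1 y1 x2 y2 δout g : ℝ → ℝ)
    (hδay : ∀ a, δay a = y0 * (1 - f) * a / (x0 + (1 - f) * a))
    (hx1 : ∀ a, x1 a = x0 + a)
    (hy1 : ∀ a, y1 a = x0 * y0 / (x0 + (1 - f) * a))
    (hx2 : ∀ a, x2 a = x1 a + δ)
    (hy2 : ∀ a, y2 a = x1 a * y1 a / (x1 a + (1 - f) * δ))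
    (hδout : ∀ a, δout a = x2 a * (1 - f) * δay a / (y2 a + (1 - f) * δay a))
    (hg : ∀ a, g a = δout a - a)
    (δo : ℝ)
    (hδo : δo = (δ * (1 - f) ^ 2 * x0 - (2 - f) * f * x0 ^ 2 +
        Real.sqrt (δ ^ 2 * (1 - f) ^ 3 * x0 * (x0 - (1 - f) ^ 2 * f * (δ + x0)))) /
        ((2 - f) * f * x0 - δ * (1 - f) ^ 2 * f)) :
    StrictMonoOn g (Set.Ioc 0 δo) ∧ StrictAntiOn g (Set.Ici δo) := by
  obtain ⟨q, hq⟩ : ∃ q, q = 1 - f := ⟨_, rfl⟩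
  have hq0 : 0 < q := by linarith
  have hfq : f = 1 - q := by linarith
  obtain ⟨U, hU⟩ : ∃ U, U = q ^ 2 * (δ + x0) - x0 := ⟨_, rfl⟩
  obtain ⟨V, hV⟩ : ∃ V, V = q ^ 2 * (x0 + q * δ) * (δ + x0) - x0 ^ 2 := ⟨_, rfl⟩
  obtain ⟨E, hE⟩ : ∃ E, E = (1 - q ^ 2) * x0 - f * q ^ 2 * δ := ⟨_, rfl⟩
  obtain ⟨D, hD⟩ : ∃ D : ℝ → ℝ, ∀ a, D a = x0 * (x0 + a) + q ^ 2 * a * (x0 + a + q * δ) :=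
    ⟨_, fun _ => rfl⟩
  have hE0 : 0 < E := by
    have : E = f * ((2 - f) * x0 - δ * (1 - f) ^ 2) := by rw [hE, hq]; ring
    rw [this]; exact mul_pos hf0 (by linarith)
  have hT : 0 < x0 - (1 - f) ^ 2 * f * (δ + x0) := by
    have : x0 - (1 - f) ^ 2 * f * (δ + x0) = E + q ^ 3 * x0 := by rw [hE, hq]; ring
    rw [this]; positivity
  obtain ⟨R, hR⟩ : ∃ R, R = Real.sqrt (δ ^ 2 * (1 - f) ^ 3 * x0 *
    (x0 - (1 - f) ^ 2 * f * (δ + x0))) := ⟨_, rfl⟩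
  have harg : 0 < δ ^ 2 * (1 - f) ^ 3 * x0 * (x0 - (1 - f) ^ 2 * f * (δ + x0)) := by
    have : 0 < 1 - f := by linarith
    positivity
  have hR0 : 0 < R := by rw [hR]; exact Real.sqrt_pos.2 harg
  have hR2 : R ^ 2 = x0 ^ 2 * U ^ 2 + E * x0 * V := by
    rw [hR, Real.sq_sqrt harg.le, hU, hE, hV, hq]; ring
  have hEo : E * δo = x0 * U + R := by
    have e1 : (2 - f) * f * x0 - δ * (1 - f) ^ 2 * f = E := by rw [hE, hq]; ring
    rw [hδo, ← hR, e1, mul_div_cancel₀ _ hE0.ne', hU, hq]; ring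
  have hso : δ * q ^ 3 * x0 < E * (x0 + δo) := by
    have : E * (x0 + δo) = δ * q ^ 3 * x0 + R := by
      rw [mul_add, hEo, hE, hU, hfq]; ring
    linarith
  have hEx : E < (1 - q ^ 2) * x0 := by
    have : 0 < f * q ^ 2 * δ := by positivity
    linarith
  have hpos : ∀ a, (0 < a ∨ δo ≤ a) → 0 < x0 + a ∧ 0 < D a := by
    intro a ha
    rcases ha with ha | ha
    · refine ⟨by positivity, ?_⟩
      rw [hD]; positivity
    · have hs1 : δ * q ^ 3 * x0 < E * (x0 + a) := by nlinarith
      have hs : 0 < x0 + a := by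
        have : 0 < δ * q ^ 3 * x0 := by positivity
        exact pos_of_mul_pos_right (this.trans hs1) hE0.le
      refine ⟨hs, ?_⟩
      have e : D a = q ^ 2 * (x0 + a) ^ 2 + q ^ 3 * δ * (x0 + a) +
          ((1 - q ^ 2) * x0 * (x0 + a) - δ * q ^ 3 * x0) := by rw [hD]; ring
      have : E * (x0 + a) < (1 - q ^ 2) * x0 * (x0 + a) := mul_lt_mul_of_pos_right hEx hs
      have h3 : 0 < q ^ 2 * (x0 + a) ^ 2 + q ^ 3 * δ * (x0 + a) := by positivity
      rw [e]; linarith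
  have hgf : ∀ a, (0 < a ∨ δo ≤ a) → g a = a * (U * a + V) / D a := by
    intro a ha
    obtain ⟨hs, hDa⟩ := hpos a ha
    have d1 : 0 < x0 + q * a := by
      have : x0 + q * a = q * (x0 + a) + f * x0 := by rw [hfq]; ring
      rw [this]; positivity
    have d2 : 0 < x0 + a + q * δ := by positivity
    have e1 : y2 a + q * δay a = y0 * D a / ((x0 + q * a) * (x0 + a + q * δ)) := by
      rw [hy2, hδay, hy1, hx1, ← hq, hD]
      field_simp
    have e2 : x2 a * q * δay a = (x0 + a + δ) * q * (y0 * q * a) / (x0 + q * a) := by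
      rw [hx2, hδay, hx1, ← hq]; field_simp
    rw [hg, hδout, ← hq, e1, e2]
    have e3 : (x0 + a + δ) * q * (y0 * q * a) / (x0 + q * a) /
        (y0 * D a / ((x0 + q * a) * (x0 + a + q * δ))) =
        (x0 + a + δ) * q ^ 2 * a * (x0 + a + q * δ) / D a := by
      have hw := d1.ne'
      generalize x0 + q * a = w at hw
      field_simp
    rw [e3, eq_div_iff hDa.ne', sub_mul, div_mul_cancel₀ _ hDa.ne', hD, hU, hV]; ring
  have key : ∀ a b, (0 < a ∨ δo ≤ a) → (0 < b ∨ δo ≤ b) →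
      g b - g a = (b - a) * (x0 / E * (R ^ 2 - (E * a - x0 * U) * (E * b - x0 * U))) /
        (D a * D b) := by
    intro a b ha hb
    obtain ⟨-, hDa⟩ := hpos a ha
    obtain ⟨-, hDb⟩ := hpos b hb
    have e : x0 / E * (R ^ 2 - (E * a - x0 * U) * (E * b - x0 * U)) =
        x0 * (x0 * V + x0 * U * (a + b) - E * (a * b)) := by
      rw [hR2]; field_simp; ring
    rw [hgf a ha, hgf b hb, e, div_sub_div _ _ hDb.ne' hDa.ne', mul_comm (D a) (D b)]
    congr 1
    rw [hD, hD, hU, hV, hE, hfq]; ring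
  constructor
  · intro a ha b hb hab
    have hA : E * a - x0 * U < R := by
      have : E * a < E * δo := mul_lt_mul_of_pos_left (hab.trans_le hb.2) hE0
      linarith
    have hB : E * b - x0 * U ≤ R := by
      have : E * b ≤ E * δo := mul_le_mul_of_nonneg_left hb.2 hE0.le
      linarith
    have hUR : x0 * U ≤ R := by
      rcases le_or_gt U 0 with h | h
      · nlinarith
      · have hVp : 0 < V := by
          have : V = x0 * U + q * δ * (U + x0) := by rw [hV, hU]; ring
          rw [this]; positivity
        have : 0 < E * x0 * V := by positivity
        apply le_of_lt
        apply lt_of_pow_lt_pow_left₀ 2 hR0.le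
        rw [hR2, mul_pow]; linarith
    have hA' : -R < E * a - x0 * U := by
      have := mul_pos hE0 ha.1
      linarith
    have hB' : -R < E * b - x0 * U := by
      have := mul_pos hE0 hb.1
      linarith
    have hk := key a b (.inl ha.1) (.inl hb.1)
    have hDa := (hpos a (.inl ha.1)).2
    have hDb := (hpos b (.inl hb.1)).2
    have hF : 0 < R ^ 2 - (E * a - x0 * U) * (E * b - x0 * U) := by
      have p1 := mul_pos (sub_pos.2 hA) (neg_lt_iff_pos_add.1 hB')
      have p2 := mul_nonneg (neg_lt_iff_pos_add.1 hA').le (sub_nonneg.2 hB)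
      generalize E * a - x0 * U = A at *
      generalize E * b - x0 * U = B at *
      linarith [show 2 * (R ^ 2 - A * B) = (R - A) * (B + R) + (A + R) * (R - B) by ring]
    have hba : 0 < b - a := sub_pos.2 hab
    have : 0 < g b - g a := by rw [hk]; positivity
    linarith
  · intro a ha b hb hab
    have ha' : δo ≤ a := ha
    have hb' : δo ≤ b := hb
    have hA : R ≤ E * a - x0 * U := by
      have : E * δo ≤ E * a := mul_le_mul_of_nonneg_left ha' hE0.le
      linarith
    have hB : R < E * b - x0 * U := by
      have : E * δo < E * b := mul_lt_mul_of_pos_left (ha'.trans_lt hab) hE0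
      linarith
    have hk := key a b (.inr ha') (.inr hb')
    have hDa := (hpos a (.inr ha')).2
    have hDb := (hpos b (.inr hb')).2
    have hF : 0 < (E * a - x0 * U) * (E * b - x0 * U) - R ^ 2 := by
      have p1 := mul_nonneg (sub_nonneg.2 hA) (hR0.trans hB).le
      have p2 := mul_pos hR0 (sub_pos.2 hB)
      generalize E * a - x0 * U = A at *
      generalize E * b - x0 * U = B at *
      linarith [show A * B - R ^ 2 = (A - R) * B + R * (B - R) by ring]
    have hba : 0 < b - a := sub_pos.2 hab
    have : 0 < g a - g b := by
      have e : g a - g b = (b - a) * (x0 / E * ((E * a - x0 * U) * (E * b - x0 * U) - R ^ 2)) /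
        (D a * D b) := by
        rw [← neg_sub (g b), hk]; ring
      rw [e]; positivity
    linarith
end

section
/- Suppose 0 < f < 1, 0 < s < 1, x0 − (1−f)²f(δ + x0) ≥ 0, and (2−f)x0 > δ(1−f)². Let δᵒ be the unconstrained optimal front-running input and δˢ the maximal front-running input for which the victim's trade with slippage tolerance s still executes (each given by its closed-form expression from Lemmas 1 and 2). Then the attacker's optimal input is min{δᵒ, δˢ}: the input min{δᵒ, δˢ} satisfies the slippage constraint, and for every a > 0 with δ̃_vy(a) ≥ (1−s)·δ_vy one has g(a) ≤ g(min{δᵒ, δˢ}). -/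
set_option maxHeartbeats 4000000

/-- Theorem 1 (optimal attack input): under the stated hypotheses, the attacker's
optimal input is `min {δᵒ, δˢ}`: it satisfies the victim's slippage constraint, and
every `a > 0` satisfying the constraint yields profit `g a ≤ g (min δᵒ δˢ)`. -/
theorem optimal_attack_input_is_min
    (x0 y0 f δ s : ℝ) (hx0 : 0 < x0) (hy0 : 0 < y0) (hf0 : 0 < f) (hf1 : f < 1)
    (hδ : 0 < δ) (hs0 : 0 < s) (hs1 : s < 1)
    (h1 : 0 ≤ x0 - (1 - f) ^ 2 * f * (δ + x0))
    (h2 : δ * (1 - f) ^ 2 < (2 - f) * x0)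
    (δvy : ℝ) (hδvy : δvy = y0 * (1 - f) * δ / (x0 + (1 - f) * δ))
    (δay x1 y1 δvyT x2 y2 δout g : ℝ → ℝ)
    (hδay : ∀ a, δay a = y0 * (1 - f) * a / (x0 + (1 - f) * a))
    (hx1 : ∀ a, x1 a = x0 + a)
    (hy1 : ∀ a, y1 a = x0 * y0 / (x0 + (1 - f) * a))
    (hδT : ∀ a, δvyT a = y1 a * (1 - f) * δ / (x1 a + (1 - f) * δ))
    (hx2 : ∀ a, x2 a = x1 a + δ)
    (hy2 : ∀ a, y2 a = x1 a * y1 a / (x1 a + (1 - f) * δ))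
    (hδout : ∀ a, δout a = x2 a * (1 - f) * δay a / (y2 a + (1 - f) * δay a))
    (hg : ∀ a, g a = δout a - a)
    (δo : ℝ)
    (hδo : δo = (δ * (1 - f) ^ 2 * x0 - (2 - f) * f * x0 ^ 2 +
        Real.sqrt (δ ^ 2 * (1 - f) ^ 3 * x0 * (x0 - (1 - f) ^ 2 * f * (δ + x0)))) /
        ((2 - f) * f * x0 - δ * (1 - f) ^ 2 * f))
    (n δs : ℝ)
    (hn : n = (1 - f) ^ 2 * (1 - s) * (δ ^ 2 * (1 - f) ^ 4 * (1 - s) +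
        2 * δ * (1 - f) ^ 2 * (2 - f * (1 - s)) * x0 +
        (4 - f * (4 - f * (1 - s))) * x0 ^ 2))
    (hδs : δs = (Real.sqrt n / (1 - s) - δ * (1 - f) ^ 3 - (2 - f) * (1 - f) * x0) /
        (2 * (1 - f) ^ 2)) :
    (1 - s) * δvy ≤ δvyT (min δo δs) ∧
      ∀ a : ℝ, 0 < a → (1 - s) * δvy ≤ δvyT a → g a ≤ g (min δo δs) := by
  obtain ⟨q, hq⟩ : ∃ q, q = 1 - f := ⟨_, rfl⟩
  have hfq : f = 1 - q := by linarith
  subst hfq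
  have hq0 : 0 < q := by linarith
  have hq1 : q < 1 := by linarith
  simp only [sub_sub_cancel] at *
  clear hq
  have hqd : 0 < q * δ := by positivity
  obtain ⟨S, hS⟩ : ∃ S, S = Real.sqrt (δ ^ 2 * q ^ 3 * x0 *
    (x0 - q ^ 2 * (1 - q) * (δ + x0))) := ⟨_, rfl⟩
  rw [← hS] at hδo
  have hS0 : 0 ≤ S := hS ▸ Real.sqrt_nonneg _
  have hSS : S ^ 2 = δ ^ 2 * q ^ 3 * x0 * (x0 - q ^ 2 * (1 - q) * (δ + x0)) := by
    rw [hS]; exact Real.sq_sqrt (by positivity)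
  obtain ⟨D, hD⟩ : ∃ D, D = (2 - (1 - q)) * (1 - q) * x0 - δ * q ^ 2 * (1 - q) := ⟨_, rfl⟩
  have hD0 : 0 < D := by
    have : D = (1 - q) * ((2 - (1 - q)) * x0 - δ * q ^ 2) := by rw [hD]; ring
    rw [this]; exact mul_pos hf0 (by linarith)
  rw [← hD] at hδo
  obtain ⟨B, hB⟩ : ∃ B, B = q ^ 2 * (x0 + δ) - x0 := ⟨_, rfl⟩
  obtain ⟨C, hC⟩ : ∃ C, C = q ^ 2 * (x0 + δ) * (x0 + q * δ) - x0 ^ 2 := ⟨_, rfl⟩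
  have hoD : D * δo = B * x0 + S := by
    rw [hδo, hB]; field_simp; ring
  have hSS2 : S ^ 2 = B ^ 2 * x0 ^ 2 + D * C * x0 := by
    rw [hSS, hB, hD, hC]; ring
  have hou : D * (δo + x0) = x0 * δ * q ^ 3 + S := by
    rw [mul_add, hoD, hB, hD]; ring
  have hou0 : 0 < δo + x0 := by
    have : 0 < D * (δo + x0) := by rw [hou]; positivity
    exact pos_of_mul_pos_right this hD0.le
  let Den : ℝ → ℝ := fun a => x0 * (x0 + a) + q ^ 2 * a * (x0 + a + q * δ)
  have hDeno : 0 < Den δo := by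
    have e : Den δo = q ^ 2 * (δo + x0) ^ 2 + δ * q ^ 2 * (δo + x0)
        + (D * (δo + x0) - x0 * δ * q ^ 3) := by
      simp only [Den]; rw [hD]; ring
    rw [e, hou]
    have : 0 < q ^ 2 * (δo + x0) ^ 2 := by positivity
    have : 0 < δ * q ^ 2 * (δo + x0) := by positivity
    linarith
  have hDenp : ∀ a, 0 < a → 0 < Den a := fun a ha => by simp only [Den]; positivity
  have hlin : ∀ a, 0 < a + x0 → 0 < x0 + q * a := fun a ha => by nlinarith
  have hgf : ∀ a, 0 < a + x0 → 0 < Den a → g a = a * (B * a + C) / Den a := by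
    intro a ha hda
    have e1 := hlin a ha
    have e2 : 0 < x0 + a + q * δ := by linarith
    have e3 : y2 a + q * δay a = y0 * Den a / ((x0 + q * a) * (x0 + a + q * δ)) := by
      rw [hy2, hy1, hx1, hδay]; simp only [Den]; field_simp
    rw [hg, hδout, e3, hx2, hx1, hδay, hB, hC]
    rw [eq_div_iff hda.ne', sub_mul]
    have e4 : (x0 + a + δ) * q * (y0 * q * a / (x0 + q * a)) /
        (y0 * Den a / ((x0 + q * a) * (x0 + a + q * δ))) * Den a
        = (x0 + a + δ) * q ^ 2 * a * (x0 + a + q * δ) := by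
      clear_value Den
      generalize x0 + q * a = u at *
      generalize x0 + a + q * δ = v at *
      have := e1.ne'
      have := e2.ne'
      have := hda.ne'
      field_simp
    rw [e4]; simp only [Den]; ring
  have hcmp : ∀ a m, 0 < a + x0 → 0 < m + x0 → 0 < Den a → 0 < Den m →
      0 ≤ (m - a) * (-D * a * m + B * x0 * (a + m) + C * x0) → g a ≤ g m := by
    intro a m ha hm hda hdm h
    rw [hgf a ha hda, hgf m hm hdm, div_le_div_iff₀ hda hdm]
    have e : m * (B * m + C) * Den a - a * (B * a + C) * Den m
        = x0 * ((m - a) * (-D * a * m + B * x0 * (a + m) + C * x0)) := by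
      simp only [Den]; rw [hB, hC, hD]; ring
    have := mul_nonneg hx0.le h
    linarith
  -- polar form at the optimum
  have hpo : ∀ a, -D * a * δo + B * x0 * (a + δo) + C * x0 = S * (δo - a) := by
    intro a
    apply mul_left_cancel₀ hD0.ne'
    linear_combination (-D * a + B * x0 - S) * hoD - hSS2
  -- slippage
  have hs' : 0 < 1 - s := by linarith
  let H : ℝ → ℝ := fun a => (1 - s) * ((x0 + q * a) * (x0 + a + q * δ))
  have hcon : ∀ a, 0 < a + x0 → ((1 - s) * δvy ≤ δvyT a ↔ H a ≤ x0 * (x0 + q * δ)) := by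
    intro a ha
    have e1 := hlin a ha
    have e2 : 0 < x0 + a + q * δ := by linarith
    have e3 : 0 < x0 + q * δ := by linarith
    have l : (1 - s) * δvy = y0 * q * δ * (1 - s) / (x0 + q * δ) := by
      rw [hδvy]; field_simp
    have r : δvyT a = y0 * q * δ * x0 / ((x0 + q * a) * (x0 + a + q * δ)) := by
      rw [hδT, hy1, hx1]; field_simp
    have k : 0 < y0 * q * δ := by positivity
    rw [l, r, div_le_div_iff₀ e3 (by positivity), mul_assoc, mul_assoc (y0 * q * δ),
      mul_le_mul_iff_right₀ k]
  have hmono : ∀ a b, 0 < a + x0 → a < b → H a < H b := by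
    intro a b ha hab
    have e1 := hlin a ha
    have e2 : 0 < x0 + a + q * δ := by linarith
    have e4 : q * a < q * b := by nlinarith
    simp only [H]
    apply mul_lt_mul_of_pos_left _ hs'
    apply mul_lt_mul'' <;> linarith
  obtain ⟨R, hR⟩ : ∃ R, R = Real.sqrt n := ⟨_, rfl⟩
  rw [← hR] at hδs
  have hR0 : 0 ≤ R := hR ▸ Real.sqrt_nonneg _
  have hn' : n = q ^ 2 * (1 - s) ^ 2 * (x0 * (1 + q) + q ^ 2 * δ) ^ 2
      + q ^ 2 * (1 - s) * (4 * q * s * x0 * (x0 + q * δ)) := by rw [hn]; ring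
  have hRR : R ^ 2 = n := by
    rw [hR]; apply Real.sq_sqrt; rw [hn']; positivity
  have hRgt : q * (1 - s) * (x0 * (1 + q) + q ^ 2 * δ) < R := by
    apply lt_of_pow_lt_pow_left₀ 2 hR0
    rw [hRR, hn']
    have : 0 < q ^ 2 * (1 - s) * (4 * q * s * x0 * (x0 + q * δ)) := by positivity
    nlinarith
  have hsE : R = (1 - s) * (2 * q ^ 2 * δs + q * (x0 * (1 + q) + q ^ 2 * δ)) := by
    rw [hδs]; field_simp; ring
  have hs0' : 0 < δs := by
    have : 0 < (1 - s) * (2 * q ^ 2) * δs := by linarith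
    exact pos_of_mul_pos_right this (by positivity)
  have hHs : H δs = x0 * (x0 + q * δ) := by
    have h := hRR
    rw [hn', hsE] at h
    have k : (4 * q ^ 3 * (1 - s)) ≠ 0 := by positivity
    apply mul_left_cancel₀ k
    simp only [H]
    linear_combination h
  have hmp : 0 < min δo δs + x0 := by
    rcases min_choice δo δs with h | h <;> rw [h] <;> linarith
  refine ⟨?_, ?_⟩
  · rw [hcon _ hmp, ← hHs]
    rcases (min_le_right δo δs).lt_or_eq with h | h
    · exact (hmono _ _ hmp h).le
    · rw [h]
  · intro a ha hca
    rcases le_or_gt δo δs with h | h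
    · rw [min_eq_left h]
      apply hcmp a δo (by linarith) hou0 (hDenp a ha) hDeno
      rw [hpo]
      have := mul_nonneg hS0 (sq_nonneg (δo - a))
      linarith
    · rw [min_eq_right h.le]
      have has : a ≤ δs := by
        by_contra! hh
        have := hmono _ _ (by linarith) hh
        rw [hcon a (by linarith)] at hca
        linarith
      apply hcmp a δs (by linarith) (by linarith) (hDenp a ha) (hDenp _ hs0')
      apply mul_nonneg (by linarith)
      have ho0 : 0 < δo := by linarith
      have hC0 : 0 ≤ C := by
        by_contra! hc
        have hB0 : B < 0 := by
          have : q ^ 2 * (x0 + δ) * x0 < x0 * x0 := by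
            have : 0 < q ^ 2 * (x0 + δ) * (q * δ) := by positivity
            nlinarith
          have := lt_of_mul_lt_mul_right this hx0.le
          linarith
        have h3 : D * C * x0 < 0 :=
          mul_neg_of_neg_of_pos (mul_neg_of_pos_of_neg hD0 hc) hx0
        have h4 : S < -(B * x0) := by
          apply lt_of_pow_lt_pow_left₀ 2 (by nlinarith)
          nlinarith
        have := mul_pos hD0 ho0
        linarith
      have hz : ∀ m, 0 ≤ m → m ≤ δo → 0 ≤ B * x0 * m + C * x0 := by
        intro m _ hm
        have k := hpo 0
        have : 0 ≤ B * x0 * δo + C * x0 := by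
          have := mul_nonneg hS0 ho0.le
          linarith
        have hcx : 0 ≤ C * x0 := by positivity
        have : 0 ≤ δo * (B * x0 * m + C * x0) := by nlinarith
        exact nonneg_of_mul_nonneg_right this ho0
      -- bilinear interpolation between 0 and the optimum
      have k1 := hz δs hs0'.le h.le
      have k2 : 0 ≤ S * (δo - δs) := mul_nonneg hS0 (by linarith)
      rw [← hpo] at k2
      have k3 : 0 ≤ (δo - a) * (B * x0 * δs + C * x0) := mul_nonneg (by linarith) k1
      have k4 := mul_nonneg ha.le k2
      have : 0 ≤ δo * (-D * a * δs + B * x0 * (a + δs) + C * x0) := by linarith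
      exact nonneg_of_mul_nonneg_right this ho0
end

section
/- Let f = 0 and 0 < s < 1, and let δ* = (1/2)(√((1−s)(δ²(1−s) + 4δx0 + 4x0²))/(1−s) − 2x0 − δ). Then δ* > 0 and the front-running input δ* pushes the victim's realized output exactly to the slippage limit: δ̃_vy(δ*) = (1−s)·δ_vy. -/
/-- Fee-free pool (`f = 0`). With slippage tolerance `0 < s < 1`, the input
`δ* = (1/2)(√((1−s)(δ²(1−s)+4δx0+4x0²))/(1−s) − 2x0 − δ)` is positive and pushes the
victim's realized output exactly to the slippage limit: `δ̃_vy(δ*) = (1−s)·δ_vy`. -/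
theorem feeless_max_input_hits_slippage_limit
    (x0 y0 δ s : ℝ) (hx0 : 0 < x0) (hy0 : 0 < y0) (hδ : 0 < δ)
    (hs0 : 0 < s) (hs1 : s < 1)
    (δvy : ℝ) (hδvy : δvy = y0 * δ / (x0 + δ))
    (x1 y1 δvyT : ℝ → ℝ)
    (hx1 : ∀ a, x1 a = x0 + a)
    (hy1 : ∀ a, y1 a = x0 * y0 / (x0 + a))
    (hδT : ∀ a, δvyT a = y1 a * δ / (x1 a + δ))
    (δstar : ℝ)
    (hδstar : δstar = (1 / 2) *
        (Real.sqrt ((1 - s) * (δ ^ 2 * (1 - s) + 4 * δ * x0 + 4 * x0 ^ 2)) / (1 - s)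
          - 2 * x0 - δ)) :
    0 < δstar ∧ δvyT δstar = (1 - s) * δvy := by
  have ht : 0 < 1 - s := by linarith
  have hP : 0 ≤ (1 - s) * (δ ^ 2 * (1 - s) + 4 * δ * x0 + 4 * x0 ^ 2) := by positivity
  have hsq := Real.sq_sqrt hP
  have hR := Real.sqrt_nonneg ((1 - s) * (δ ^ 2 * (1 - s) + 4 * δ * x0 + 4 * x0 ^ 2))
  set R := Real.sqrt ((1 - s) * (δ ^ 2 * (1 - s) + 4 * δ * x0 + 4 * x0 ^ 2)) with hRdef
  obtain ⟨q, hq⟩ : ∃ q, q = R / (1 - s) := ⟨_, rfl⟩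
  have hq0 : 0 ≤ q := by rw [hq]; positivity
  have hRq : R = q * (1 - s) := by rw [hq]; field_simp
  rw [← hq] at hδstar
  have hkey : q ^ 2 * (1 - s) = δ ^ 2 * (1 - s) + 4 * δ * x0 + 4 * x0 ^ 2 := by
    apply mul_left_cancel₀ ht.ne'
    rw [← hsq, hRq]; ring
  have hlt : 2 * x0 + δ < q := by
    apply lt_of_pow_lt_pow_left₀ 2 hq0
    apply lt_of_mul_lt_mul_right _ ht.le
    rw [hkey]
    have : 0 < s * (x0 * (x0 + δ)) := by positivity
    nlinarith
  have hpos : 0 < δstar := by rw [hδstar]; linarith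
  refine ⟨hpos, ?_⟩
  have hq2 : q = 2 * δstar + 2 * x0 + δ := by rw [hδstar]; ring
  have hprod : (x0 + δstar) * (x0 + δstar + δ) * (1 - s) = x0 * (x0 + δ) := by
    rw [hq2] at hkey
    linarith
  rw [hδT, hy1, hx1, hδvy]
  have h1 : 0 < x0 + δstar := by linarith
  have h2 : 0 < x0 + δstar + δ := by linarith
  have h3 : 0 < x0 + δ := by linarith
  rw [div_mul_eq_mul_div, div_div, ← mul_div_assoc, div_eq_div_iff (by positivity) (by positivity)]
  linear_combination (-(y0 * δ)) * hprod
end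

section
/- Let f = 0 and 0 < s < 1, and let δ* = (1/2)(√((1−s)(δ²(1−s) + 4δx0 + 4x0²))/(1−s) − 2x0 − δ). Then the attacker's gross profit at the input δ* equals g(δ*) = δ·s·(δ + x0)/(δ·s + x0). -/
/-- Fee-free pool (`f = 0`). At the optimal constrained input
`δ* = (1/2)(√((1−s)(δ²(1−s)+4δx0+4x0²))/(1−s) − 2x0 − δ)` the attacker's gross profit
equals `g(δ*) = δ·s·(δ+x0)/(δ·s+x0)`. -/
theorem feeless_profit_at_optimal_input
    (x0 y0 δ s : ℝ) (hx0 : 0 < x0) (hy0 : 0 < y0) (hδ : 0 < δ)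
    (hs0 : 0 < s) (hs1 : s < 1)
    (δay x1 y1 x2 y2 δout g : ℝ → ℝ)
    (hδay : ∀ a, δay a = y0 * a / (x0 + a))
    (hx1 : ∀ a, x1 a = x0 + a)
    (hy1 : ∀ a, y1 a = x0 * y0 / (x0 + a))
    (hx2 : ∀ a, x2 a = x1 a + δ)
    (hy2 : ∀ a, y2 a = x1 a * y1 a / (x1 a + δ))
    (hδout : ∀ a, δout a = x2 a * δay a / (y2 a + δay a))
    (hg : ∀ a, g a = δout a - a)
    (δstar : ℝ)
    (hδstar : δstar = (1 / 2) *
        (Real.sqrt ((1 - s) * (δ ^ 2 * (1 - s) + 4 * δ * x0 + 4 * x0 ^ 2)) / (1 - s)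
          - 2 * x0 - δ)) :
    g δstar = δ * s * (δ + x0) / (δ * s + x0) := by
  have h1s : 0 < 1 - s := by linarith
  set Q := (1 - s) * (δ ^ 2 * (1 - s) + 4 * δ * x0 + 4 * x0 ^ 2) with hQ
  have hQ0 : 0 ≤ Q := by positivity
  have hsq := Real.sq_sqrt hQ0
  have hr := Real.sqrt_nonneg Q
  obtain ⟨u, hu⟩ : ∃ u, u = x0 + δstar := ⟨_, rfl⟩
  have hR : Real.sqrt Q = (1 - s) * (2 * u + δ) := by
    rw [hu, hδstar]; field_simp; ring
  rw [hR] at hsq hr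
  have hP : (1 - s) * (u * (u + δ)) = x0 * (x0 + δ) := by
    have : (1 - s) * ((1 - s) * (u * (u + δ))) = (1 - s) * (x0 * (x0 + δ)) := by
      rw [hQ] at hsq; linarith
    exact mul_left_cancel₀ h1s.ne' this
  have h2u : 0 ≤ 2 * u + δ := nonneg_of_mul_nonneg_right hr h1s
  have hPpos : 0 < u * (u + δ) := by
    have : 0 < (1 - s) * (u * (u + δ)) := by rw [hP]; positivity
    exact (mul_pos_iff_of_pos_left h1s).1 this
  have hupos : 0 < u := by
    by_contra h
    push Not at h
    nlinarith
  have ha : δstar = u - x0 := by linarith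
  have hD : 0 < u * (u + δ) - x0 * δ := by nlinarith [mul_pos hs0 hPpos, mul_pos hx0 hx0]
  have hud : 0 < u + δ := by linarith
  have key : g δstar = δ * (u * (u + δ) - x0 * (x0 + δ)) / (u * (u + δ) - x0 * δ) := by
    have e1 : y2 δstar + δay δstar = y0 * (u * (u + δ) - x0 * δ) / (u * (u + δ)) := by
      rw [hy2, hx1, hy1, hδay, ← hu, ha]
      field_simp
      ring
    rw [hg, hδout, e1, hx2, hx1, hδay, ← hu, ha]
    have := hD.ne'
    rw [eq_div_iff this]
    generalize hE : u * (u + δ) - x0 * δ = E at *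
    field_simp
    rw [← hE]
    ring
  rw [key, div_eq_div_iff hD.ne' (by positivity)]
  linear_combination (δ * x0) * hP
end

section
/- Let f = 0 and 0 < s < 1, and let δ* = (1/2)(√((1−s)(δ²(1−s) + 4δx0 + 4x0²))/(1−s) − 2x0 − δ). Then the victim's loss expressed in tokens X, L_v = s·δ_vy·(x2(δ*)/y2(δ*)), equals s·δ·(δ + √(δ² + (4δx0 + 4x0²)/(1−s)))² / (4x0(δ + x0)). -/
/-- Fee-free pool (`f = 0`). With `δ*` the optimal constrained input, the victim's
loss expressed in tokens X, `L_v = s·δ_vy·(x2(δ*)/y2(δ*))`, equals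
`s·δ·(δ + √(δ² + (4δx0+4x0²)/(1−s)))² / (4x0(δ+x0))`. -/
theorem feeless_victim_loss_closed_form
    (x0 y0 δ s : ℝ) (hx0 : 0 < x0) (hy0 : 0 < y0) (hδ : 0 < δ)
    (hs0 : 0 < s) (hs1 : s < 1)
    (δvy : ℝ) (hδvy : δvy = y0 * δ / (x0 + δ))
    (x1 y1 x2 y2 : ℝ → ℝ)
    (hx1 : ∀ a, x1 a = x0 + a)
    (hy1 : ∀ a, y1 a = x0 * y0 / (x0 + a))
    (hx2 : ∀ a, x2 a = x1 a + δ)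
    (hy2 : ∀ a, y2 a = x1 a * y1 a / (x1 a + δ))
    (δstar : ℝ)
    (hδstar : δstar = (1 / 2) *
        (Real.sqrt ((1 - s) * (δ ^ 2 * (1 - s) + 4 * δ * x0 + 4 * x0 ^ 2)) / (1 - s)
          - 2 * x0 - δ)) :
    s * δvy * (x2 δstar / y2 δstar) =
      s * δ * (δ + Real.sqrt (δ ^ 2 + (4 * δ * x0 + 4 * x0 ^ 2) / (1 - s))) ^ 2 /
        (4 * x0 * (δ + x0)) := by
  have h1 : 0 < 1 - s := by linarith
  have hR : Real.sqrt ((1 - s) * (δ ^ 2 * (1 - s) + 4 * δ * x0 + 4 * x0 ^ 2)) / (1 - s)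
      = Real.sqrt (δ ^ 2 + (4 * δ * x0 + 4 * x0 ^ 2) / (1 - s)) := by
    have e : (1 - s) * (δ ^ 2 * (1 - s) + 4 * δ * x0 + 4 * x0 ^ 2)
        = (1 - s) ^ 2 * (δ ^ 2 + (4 * δ * x0 + 4 * x0 ^ 2) / (1 - s)) := by
      field_simp
      ring
    rw [e, Real.sqrt_mul (by positivity), Real.sqrt_sq h1.le]
    field_simp
  rw [hR] at hδstar
  have hlt : δ < Real.sqrt (δ ^ 2 + (4 * δ * x0 + 4 * x0 ^ 2) / (1 - s)) := by
    apply Real.lt_sqrt_of_sq_lt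
    have : 0 < (4 * δ * x0 + 4 * x0 ^ 2) / (1 - s) := by positivity
    linarith
  generalize Real.sqrt (δ ^ 2 + (4 * δ * x0 + 4 * x0 ^ 2) / (1 - s)) = R at *
  have ha : x0 + δstar = (R - δ) / 2 := by rw [hδstar]; ring
  have hp : 0 < R - δ := by linarith
  have hq : 0 < R + δ := by linarith
  have hb : (R - δ) / 2 + δ = (R + δ) / 2 := by ring
  rw [hx2, hy2, hy1, hx1, ha, hb, hδvy]
  have hp' := hp.ne'
  have hq' := hq.ne'
  have hz : x0 + δ ≠ 0 := by positivity
  rw [add_comm δ x0, add_comm δ R]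
  field_simp
  try ring
end

section
/- Let f = 0 and 0 < s < 1, and let δ* = (1/2)(√((1−s)(δ²(1−s) + 4δx0 + 4x0²))/(1−s) − 2x0 − δ). With P_a = g(δ*) the attacker's gross profit and L_v = s·δ_vy·(x2(δ*)/y2(δ*)) the victim's loss in tokens X, one has P_a/L_v ≤ x0/(δ·s + x0) ≤ 1; in particular the attacker's profit cannot exceed the victim's loss: P_a ≤ L_v. -/
/-- Theorem 2 (profit cannot exceed loss), fee-free pool (`f = 0`), `0 < s < 1`.
With `P_a = g(δ*)` the attacker's gross profit at the optimal constrained input and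
`L_v = s·δ_vy·(x2(δ*)/y2(δ*))` the victim's loss in tokens X, one has
`P_a/L_v ≤ x0/(δ·s+x0) ≤ 1`, and in particular `P_a ≤ L_v`. -/
theorem profit_cannot_exceed_loss
    (x0 y0 δ s : ℝ) (hx0 : 0 < x0) (hy0 : 0 < y0) (hδ : 0 < δ)
    (hs0 : 0 < s) (hs1 : s < 1)
    (δvy : ℝ) (hδvy : δvy = y0 * δ / (x0 + δ))
    (δay x1 y1 x2 y2 δout g : ℝ → ℝ)
    (hδay : ∀ a, δay a = y0 * a / (x0 + a))
    (hx1 : ∀ a, x1 a = x0 + a)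
    (hy1 : ∀ a, y1 a = x0 * y0 / (x0 + a))
    (hx2 : ∀ a, x2 a = x1 a + δ)
    (hy2 : ∀ a, y2 a = x1 a * y1 a / (x1 a + δ))
    (hδout : ∀ a, δout a = x2 a * δay a / (y2 a + δay a))
    (hg : ∀ a, g a = δout a - a)
    (δstar : ℝ)
    (hδstar : δstar = (1 / 2) *
        (Real.sqrt ((1 - s) * (δ ^ 2 * (1 - s) + 4 * δ * x0 + 4 * x0 ^ 2)) / (1 - s)
          - 2 * x0 - δ))
    (Pa Lv : ℝ) (hPa : Pa = g δstar)
    (hLv : Lv = s * δvy * (x2 δstar / y2 δstar)) :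
    Pa / Lv ≤ x0 / (δ * s + x0) ∧ x0 / (δ * s + x0) ≤ 1 ∧ Pa ≤ Lv := by
  have h1s : 0 < 1 - s := by linarith
  set R := Real.sqrt ((1 - s) * (δ ^ 2 * (1 - s) + 4 * δ * x0 + 4 * x0 ^ 2)) with hR
  have hRn : 0 ≤ R := Real.sqrt_nonneg _
  have hRsq : R ^ 2 = (1 - s) * (δ ^ 2 * (1 - s) + 4 * δ * x0 + 4 * x0 ^ 2) :=
    Real.sq_sqrt (by positivity)
  have hRe : R = (1 - s) * (2 * δstar + 2 * x0 + δ) := by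
    rw [hδstar]; field_simp; ring
  clear_value R
  set a := δstar with ha
  clear_value a
  have hsum : 0 ≤ 2 * a + 2 * x0 + δ := by
    by_contra hc
    push Not at hc
    have := mul_neg_of_pos_of_neg h1s hc
    linarith
  have hkey : (1 - s) * ((x0 + a) * (x0 + a + δ)) = x0 * (x0 + δ) := by
    rw [hRe] at hRsq
    have h2 : (1 - s) * ((1 - s) * ((x0 + a) * (x0 + a + δ))) = (1 - s) * (x0 * (x0 + δ)) := by
      linarith
    exact mul_left_cancel₀ h1s.ne' h2
  have hapos : 0 < a := by
    by_contra hc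
    push Not at hc
    have h3 : (x0 + a) * (x0 + a + δ) ≤ x0 * (x0 + δ) := by nlinarith
    have h4 : 0 < x0 * (x0 + δ) := by positivity
    nlinarith
  have hs : s = a * (2 * x0 + a + δ) / ((x0 + a) * (x0 + a + δ)) := by
    rw [eq_div_iff (by positivity)]; linarith
  have hD : 0 < (x0 + a) ^ 2 + a * δ := by positivity
  have hPa' : Pa = a * δ * (2 * x0 + a + δ) / ((x0 + a) ^ 2 + a * δ) := by
    have e : y2 a + δay a = y0 * ((x0 + a) ^ 2 + a * δ) / ((x0 + a) * (x0 + a + δ)) := by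
      rw [hy2, hδay, hx1, hy1]; field_simp; ring
    rw [hPa, hg, hδout, e, hx2, hx1, hδay]; field_simp; ring
  have hLv' : Lv = δ * a * (2 * x0 + a + δ) * (x0 + a + δ) / ((x0 + a) * (x0 + δ) * x0) := by
    rw [hLv, hδvy, hx2, hy2, hx1, hy1, hs]; field_simp
  have hLpos : 0 < Lv := by rw [hLv']; positivity
  have hB : x0 / (δ * s + x0) ≤ 1 := by
    rw [div_le_one (by positivity)]; nlinarith [mul_pos hδ hs0]
  have hA : Pa / Lv ≤ x0 / (δ * s + x0) := by
    have e1 : Pa / Lv = (x0 + a) * (x0 + δ) * x0 / (((x0 + a) ^ 2 + a * δ) * (x0 + a + δ)) := by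
      rw [hPa', hLv']; field_simp
    have e2 : x0 / (δ * s + x0) = x0 * ((x0 + a) * (x0 + a + δ)) /
        (δ * (a * (2 * x0 + a + δ)) + x0 * ((x0 + a) * (x0 + a + δ))) := by
      rw [hs]; field_simp
    rw [e1, e2, div_le_div_iff₀ (by positivity) (by positivity), ← sub_nonneg]
    have h5 : 0 ≤ ((x0 + a) ^ 2 + a * δ) * (x0 + a + δ) ^ 2
        - (x0 + δ) * (δ * (a * (2 * x0 + a + δ)) + x0 * ((x0 + a) * (x0 + a + δ))) := by
      ring_nf; positivity
    have h6 := mul_nonneg (by positivity : 0 ≤ x0 * (x0 + a)) h5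
    linarith
  refine ⟨hA, hB, ?_⟩
  exact (div_le_one hLpos).1 (hA.trans hB)
end

section
/- Let f = 0. As the front-running input tends to infinity, the attacker's gross profit tends to the victim's entire input: lim_{a→∞} g(a) = lim_{a→∞} (δ_out(a) − a) = δ. -/
/-- Fee-free pool (`f = 0`). As the front-running input tends to infinity, the
attacker's gross profit tends to the victim's entire input:
`lim_{a→∞} g(a) = lim_{a→∞} (δout(a) − a) = δ`. -/
theorem profit_limit_is_victim_input
    (x0 y0 δ : ℝ) (hx0 : 0 < x0) (hy0 : 0 < y0) (hδ : 0 < δ)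
    (δay x1 y1 x2 y2 δout g : ℝ → ℝ)
    (hδay : ∀ a, δay a = y0 * a / (x0 + a))
    (hx1 : ∀ a, x1 a = x0 + a)
    (hy1 : ∀ a, y1 a = x0 * y0 / (x0 + a))
    (hx2 : ∀ a, x2 a = x1 a + δ)
    (hy2 : ∀ a, y2 a = x1 a * y1 a / (x1 a + δ))
    (hδout : ∀ a, δout a = x2 a * δay a / (y2 a + δay a))
    (hg : ∀ a, g a = δout a - a) :
    Filter.Tendsto g Filter.atTop (nhds δ) := by
  have hD : Filter.Tendsto (fun a : ℝ => a * (a + 2 * x0 + δ) + x0 ^ 2) Filter.atTop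
      Filter.atTop := by
    refine Filter.tendsto_atTop_mono' _ ?_ Filter.tendsto_id
    filter_upwards [Filter.eventually_ge_atTop (1 : ℝ)] with a ha
    simp only [id]
    nlinarith [sq_nonneg x0, mul_pos (by linarith : (0 : ℝ) < a) hx0,
      mul_pos (by linarith : (0 : ℝ) < a) hδ]
  have hlim : Filter.Tendsto
      (fun a : ℝ => δ - δ * x0 ^ 2 / (a * (a + 2 * x0 + δ) + x0 ^ 2)) Filter.atTop (nhds δ) := by
    simpa using (tendsto_const_nhds (x := δ)).sub
      ((tendsto_const_nhds (x := δ * x0 ^ 2)).div_atTop hD)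
  refine hlim.congr' ?_
  filter_upwards [Filter.eventually_gt_atTop (0 : ℝ)] with a ha
  rw [hg, hδout, hy2, hx2, hδay, hy1, hx1]
  have h1 : x0 + a ≠ 0 := by positivity
  have h2 : x0 + a + δ ≠ 0 := by positivity
  have h3 : a * (a + 2 * x0 + δ) + x0 ^ 2 ≠ 0 := by positivity
  have h4 : (x0 + a) * (x0 * y0 / (x0 + a)) / (x0 + a + δ) + y0 * a / (x0 + a)
      = y0 * (a * (a + 2 * x0 + δ) + x0 ^ 2) / ((x0 + a) * (x0 + a + δ)) := by
    field_simp
    ring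
  rw [h4]
  field_simp
  ring
end

section
/- Let f = 0. For every front-running input a > 0, the attacker's gross profit is strictly smaller than the victim's entire input: g(a) < δ. -/
/-- Fee-free pool (`f = 0`). For every front-running input `a > 0`, the attacker's
gross profit is strictly smaller than the victim's entire input: `g(a) < δ`. -/
theorem profit_less_than_victim_input
    (x0 y0 δ : ℝ) (hx0 : 0 < x0) (hy0 : 0 < y0) (hδ : 0 < δ)
    (δay x1 y1 x2 y2 δout g : ℝ → ℝ)
    (hδay : ∀ a, δay a = y0 * a / (x0 + a))
    (hx1 : ∀ a, x1 a = x0 + a)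
    (hy1 : ∀ a, y1 a = x0 * y0 / (x0 + a))
    (hx2 : ∀ a, x2 a = x1 a + δ)
    (hy2 : ∀ a, y2 a = x1 a * y1 a / (x1 a + δ))
    (hδout : ∀ a, δout a = x2 a * δay a / (y2 a + δay a))
    (hg : ∀ a, g a = δout a - a) :
    ∀ a : ℝ, 0 < a → g a < δ := by
  intro a ha
  have hS : 0 < x0 + a := by positivity
  have hT : 0 < x0 + a + δ := by positivity
  have hD : 0 < x0 * (x0 + a) + a * (x0 + a + δ) := by positivity
  have h2 : y2 a = x0 * y0 / (x0 + a + δ) := by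
    rw [hy2, hx1, hy1]
    field_simp
  have hsum : y2 a + δay a
      = y0 * (x0 * (x0 + a) + a * (x0 + a + δ)) / ((x0 + a + δ) * (x0 + a)) := by
    rw [h2, hδay]
    field_simp
  have hout : δout a
      = (x0 + a + δ) ^ 2 * a / (x0 * (x0 + a) + a * (x0 + a + δ)) := by
    rw [hδout, hsum, hx2, hx1, hδay]
    field_simp
  have key : δout a < a + δ := by
    rw [hout, div_lt_iff₀ hD]
    have h : 0 < x0 * (x0 * δ) := by positivity
    nlinarith
  rw [hg]
  linarith
end

section
/- Let f = 0, 0 < s < 1, and base fee b ≥ 0 (in tokens X), and let δ* = (1/2)(√((1−s)(δ²(1−s) + 4δx0 + 4x0²))/(1−s) − 2x0 − δ) with victim loss L_v = s·δ_vy·(x2(δ*)/y2(δ*)). If L_v < 2b, then no profitable sandwich attack exists: for every front-running input a > 0 satisfying the slippage constraint δ̃_vy(a) ≥ (1−s)·δ_vy, the attacker's net profit satisfies g(a) − 2b < 0. -/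
/-- Fee-free pool (`f = 0`), slippage tolerance `0 < s < 1`, base fee `b ≥ 0` in
tokens X. If the victim's loss `L_v = s·δ_vy·(x2(δ*)/y2(δ*))` at the optimal
constrained input `δ*` satisfies `L_v < 2b`, then no profitable sandwich attack
exists: every front-run `a > 0` respecting the slippage constraint
`δ̃_vy(a) ≥ (1−s)·δ_vy` yields net profit `g(a) − 2b < 0`. -/
theorem no_profitable_attack_below_base_fee
    (x0 y0 δ s b : ℝ) (hx0 : 0 < x0) (hy0 : 0 < y0) (hδ : 0 < δ)
    (hs0 : 0 < s) (hs1 : s < 1) (hb : 0 ≤ b)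
    (δvy : ℝ) (hδvy : δvy = y0 * δ / (x0 + δ))
    (δay x1 y1 δvyT x2 y2 δout g : ℝ → ℝ)
    (hδay : ∀ a, δay a = y0 * a / (x0 + a))
    (hx1 : ∀ a, x1 a = x0 + a)
    (hy1 : ∀ a, y1 a = x0 * y0 / (x0 + a))
    (hδT : ∀ a, δvyT a = y1 a * δ / (x1 a + δ))
    (hx2 : ∀ a, x2 a = x1 a + δ)
    (hy2 : ∀ a, y2 a = x1 a * y1 a / (x1 a + δ))
    (hδout : ∀ a, δout a = x2 a * δay a / (y2 a + δay a))
    (hg : ∀ a, g a = δout a - a)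
    (δstar : ℝ)
    (hδstar : δstar = (1 / 2) *
        (Real.sqrt ((1 - s) * (δ ^ 2 * (1 - s) + 4 * δ * x0 + 4 * x0 ^ 2)) / (1 - s)
          - 2 * x0 - δ))
    (Lv : ℝ) (hLv : Lv = s * δvy * (x2 δstar / y2 δstar))
    (hLvb : Lv < 2 * b) :
    ∀ a : ℝ, 0 < a → (1 - s) * δvy ≤ δvyT a → g a - 2 * b < 0 := by
  intro a ha hc
  have hq : 0 < 1 - s := by linarith
  have hP : 0 < x0 * (x0 + δ) := by positivity
  obtain ⟨X, hX⟩ : ∃ X, X = x0 + δstar := ⟨_, rfl⟩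
  have harg : 0 ≤ (1 - s) * (δ ^ 2 * (1 - s) + 4 * δ * x0 + 4 * x0 ^ 2) := by positivity
  have hr := Real.sq_sqrt harg
  have hr0 := Real.sqrt_nonneg ((1 - s) * (δ ^ 2 * (1 - s) + 4 * δ * x0 + 4 * x0 ^ 2))
  generalize Real.sqrt ((1 - s) * (δ ^ 2 * (1 - s) + 4 * δ * x0 + 4 * x0 ^ 2)) = r at *
  have ht0 : 0 ≤ 2 * X + δ := by
    have : 2 * X + δ = r / (1 - s) := by rw [hX, hδstar]; ring
    rw [this]; positivity
  have hrt : r = (2 * X + δ) * (1 - s) := by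
    have : 2 * X + δ = r / (1 - s) := by rw [hX, hδstar]; ring
    rw [this]; field_simp
  have hu : (1 - s) * (X * (X + δ)) = x0 * (x0 + δ) := by
    rw [hrt] at hr
    have : (1 - s) * ((1 - s) * (X * (X + δ)) - x0 * (x0 + δ)) = 0 := by linarith
    rcases mul_eq_zero.mp this with h | h <;> linarith
  have hw : 0 < x0 + a := by positivity
  have hc' : (1 - s) * ((x0 + a) * (x0 + a + δ)) ≤ x0 * (x0 + δ) := by
    rw [hδT, hy1, hx1, hδvy] at hc
    have e1 : (1 - s) * (y0 * δ / (x0 + δ)) = (y0 * δ * (1 - s)) / (x0 + δ) := by ring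
    have e2 : x0 * y0 / (x0 + a) * δ / (x0 + a + δ)
        = (y0 * δ * x0) / ((x0 + a) * (x0 + a + δ)) := by field_simp
    rw [e1, e2, div_le_div_iff₀ (by positivity) (by positivity)] at hc
    have : 0 < y0 * δ := by positivity
    refine le_of_mul_le_mul_left ?_ this
    linarith
  have hwu : (x0 + a) * (x0 + a + δ) ≤ X * (X + δ) := by
    refine le_of_mul_le_mul_left ?_ hq
    linarith
  have hXw : x0 + a ≤ X := by
    by_contra h
    push Not at h
    nlinarith [mul_pos (sub_pos.mpr h) (show 0 < X + (x0 + a) + δ by linarith)]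
  have hX0 : 0 < X := by linarith
  have hXx : x0 ≤ X := by linarith
  obtain ⟨h, hh⟩ : ∃ h, h = a * (2 * x0 + a + δ) := ⟨_, rfl⟩
  obtain ⟨H, hH⟩ : ∃ H, H = X * (X + δ) - x0 * (x0 + δ) := ⟨_, rfl⟩
  have hh0 : 0 < h := by rw [hh]; positivity
  have hhH : h ≤ H := by rw [hh, hH]; linarith
  have hsH : s * (X * (X + δ)) = H := by rw [hH]; linarith
  have hga : g a = δ * h / (h + x0 ^ 2) := by
    have hd : (x0 + a) ^ 2 + a * δ = h + x0 ^ 2 := by rw [hh]; ring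
    rw [hg, hδout, hx2, hy2, hδay, hy1, hx1, ← hd, hh]
    have : 0 < (x0 + a) ^ 2 + a * δ := by positivity
    have e : (x0 + a) * (x0 * y0 / (x0 + a)) / (x0 + a + δ) + y0 * a / (x0 + a)
        = y0 * ((x0 + a) ^ 2 + a * δ) / ((x0 + a) * (x0 + a + δ)) := by
      field_simp; ring
    rw [e]
    field_simp
    ring
  have hL : Lv = δ * (s * (X + δ) ^ 2) / (x0 * (x0 + δ)) := by
    rw [hLv, hx2, hy2, hy1, hx1, hδvy, ← hX]
    field_simp
  have hkey : h * (x0 * (x0 + δ)) ≤ s * (X + δ) ^ 2 * (h + x0 ^ 2) := by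
    refine le_of_mul_le_mul_left ?_ hX0
    have e : X * (s * (X + δ) ^ 2 * (h + x0 ^ 2)) = (X + δ) * (H * (h + x0 ^ 2)) := by
      rw [← hsH]; ring
    rw [e]
    have k1 : h * (H + x0 ^ 2) ≤ H * (h + x0 ^ 2) := by
      linarith [mul_le_mul_of_nonneg_right hhH (sq_nonneg x0)]
    have k2 : X * (x0 * (x0 + δ)) ≤ (X + δ) * (H + x0 ^ 2) := by
      have e3 : H + x0 ^ 2 = X ^ 2 + (X - x0) * δ := by rw [hH]; ring
      have k3 : X ^ 2 ≤ H + x0 ^ 2 := by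
        rw [e3]
        linarith [mul_nonneg (sub_nonneg.mpr hXx) hδ.le]
      have k4 : x0 * (x0 + δ) ≤ X * (X + δ) := by linarith
      linarith [mul_le_mul_of_nonneg_left k3 (show 0 ≤ X + δ by linarith),
        mul_le_mul_of_nonneg_left k4 hX0.le]
    calc X * (h * (x0 * (x0 + δ))) = h * (X * (x0 * (x0 + δ))) := by ring
      _ ≤ h * ((X + δ) * (H + x0 ^ 2)) := mul_le_mul_of_nonneg_left k2 hh0.le
      _ = (X + δ) * (h * (H + x0 ^ 2)) := by ring
      _ ≤ _ := mul_le_mul_of_nonneg_left k1 (by linarith)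
  have : g a ≤ Lv := by
    rw [hga, hL, div_le_div_iff₀ (by positivity) hP]
    linarith [mul_le_mul_of_nonneg_left hkey hδ.le]
  linarith
end
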